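/- arXiv:1907.08117 — 5 statements merged into one kernel-verified Lean document; each statement's English description precedes it below -/
import Mathlib

section
/- Let a > 0. Then there exists a positive constant C, depending only on a, such that for all reals 0 ≤ s < s', 0 ≤ t < t' and every ε > 0, ε⁴ · ∫_Ω √(x₁x₂x₃x₄) √(y₁y₂y₃y₄) · exp(−a[(x₄−x₃)y₃ + (y₄−y₃)x₃ + (x₂−x₁)y₁ + (y₂−y₁)x₁]) dx₁dx₂dx₃dx₄ dy₁dy₂dy₃dy₄ ≤ C (s'−s)²(t'−t)², where the integration region is Ω = {(x₁,…,x₄,y₁,…,y₄) : s/ε ≤ x₁ ≤ x₂ ≤ x₃ ≤ x₄ ≤ s'/ε and t/ε ≤ y₁ ≤ y₂ ≤ y₃ ≤ y₄ ≤ t'/ε}. -/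
open MeasureTheory Filter Set

theorem measurePreserving_finFour_pairs :
    MeasurePreserving (fun v : Fin 4 → ℝ => ((v 0, v 1), (v 2, v 3))) volume volume := by
  have h1 := volume_preserving_piFinSuccAbove (fun _ : Fin 4 => ℝ) 0
  have h2 := volume_preserving_piFinSuccAbove (fun _ : Fin 3 => ℝ) 0
  have h3 := volume_preserving_finTwoArrow ℝ
  have h4 : MeasurePreserving (MeasurableEquiv.prodAssoc (α := ℝ) (β := ℝ) (γ := ℝ × ℝ)).symm
      volume volume := (measurePreserving_prodAssoc _ _ _).symm _
  exact h4.comp (((MeasurePreserving.id volume).prod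
    (((MeasurePreserving.id volume).prod h3).comp h2)).comp h1)

theorem lintegral_finFour_prod_mul {g : (ℝ × ℝ) × (ℝ × ℝ) → ENNReal} (hg : Measurable g) :
    ∫⁻ p : (Fin 4 → ℝ) × (Fin 4 → ℝ),
        g ((p.1 0, p.1 1), (p.2 0, p.2 1)) * g ((p.1 2, p.1 3), (p.2 2, p.2 3)) =
      (∫⁻ z, g z) * ∫⁻ z, g z := by
  have hm := measurePreserving_finFour_pairs.prod measurePreserving_finFour_pairs
  have hh : Measurable fun x : ℝ × ℝ => ∫⁻ y, g (x, y) := hg.lintegral_prod_right'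
  have hG : Measurable fun w : ((ℝ × ℝ) × (ℝ × ℝ)) × ((ℝ × ℝ) × (ℝ × ℝ)) =>
      g (w.1.1, w.2.1) * g (w.1.2, w.2.2) := by fun_prop
  calc _ = ∫⁻ w : ((ℝ × ℝ) × (ℝ × ℝ)) × ((ℝ × ℝ) × (ℝ × ℝ)),
        g (w.1.1, w.2.1) * g (w.1.2, w.2.2) := hm.lintegral_comp hG
    _ = ∫⁻ x : (ℝ × ℝ) × (ℝ × ℝ), ∫⁻ y : (ℝ × ℝ) × (ℝ × ℝ),
        g (x.1, y.1) * g (x.2, y.2) := lintegral_prod _ hG.aemeasurable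
    _ = ∫⁻ x : (ℝ × ℝ) × (ℝ × ℝ), (∫⁻ y, g (x.1, y)) * ∫⁻ y, g (x.2, y) := by
      refine lintegral_congr fun x => ?_
      exact lintegral_prod_mul (μ := volume) (ν := volume) (f := fun y => g (x.1, y))
        (g := fun y => g (x.2, y)) (by fun_prop) (by fun_prop)
    _ = (∫⁻ x, ∫⁻ y, g (x, y)) * ∫⁻ x, ∫⁻ y, g (x, y) :=
      lintegral_prod_mul (μ := volume) (ν := volume) hh.aemeasurable hh.aemeasurable
    _ = _ := by
      rw [← lintegral_prod (μ := volume) (ν := volume) _ hg.aemeasurable]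
      rfl

/-- Tonelli's theorem in coordinates given by the starting points and the increments of two
pairs. -/
theorem lintegral_pairs_eq_increments {g : (ℝ × ℝ) × (ℝ × ℝ) → ENNReal} (hg : Measurable g)
    (S T : ℝ) :
    ∫⁻ z, g z = ∫⁻ x, ∫⁻ y, ∫⁻ u, ∫⁻ v, g ((S + x, S + x + u), (T + y, T + y + v)) := by
  calc ∫⁻ z, g z = ∫⁻ p : ℝ × ℝ, ∫⁻ q : ℝ × ℝ, g (p, q) :=
      lintegral_prod _ hg.aemeasurable
    _ = ∫⁻ x, ∫⁻ x', ∫⁻ q : ℝ × ℝ, g ((x, x'), q) :=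
      lintegral_prod (μ := volume) (ν := volume) _
        (hg.lintegral_prod_right' (ν := volume)).aemeasurable
    _ = ∫⁻ x, ∫⁻ x', ∫⁻ y, ∫⁻ y', g ((x, x'), (y, y')) := by
      refine lintegral_congr fun x => lintegral_congr fun x' => ?_
      exact lintegral_prod (μ := volume) (ν := volume) (fun q => g ((x, x'), q))
        (by fun_prop)
    _ = ∫⁻ x, ∫⁻ y, ∫⁻ x', ∫⁻ y', g ((x, x'), (y, y')) := by
      refine lintegral_congr fun x => lintegral_lintegral_swap ?_
      have : Measurable fun w : (ℝ × ℝ) × ℝ => g ((x, w.1.1), (w.1.2, w.2)) := by fun_prop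
      exact (this.lintegral_prod_right' (ν := volume)).aemeasurable
    _ = _ := by
      rw [← lintegral_add_left_eq_self _ S]
      refine lintegral_congr fun x => ?_
      rw [← lintegral_add_left_eq_self _ T]
      refine lintegral_congr fun y => ?_
      rw [← lintegral_add_left_eq_self _ (S + x)]
      refine lintegral_congr fun u => ?_
      rw [← lintegral_add_left_eq_self _ (T + y)]

theorem lintegral_le_setLIntegral_Ioc {L : ℝ} {h k : ℝ → ENNReal}
    (h0 : ∀ x, x ∉ Icc 0 L → h x = 0) (hk : ∀ x ∈ Ioc 0 L, h x ≤ k x) :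
    ∫⁻ x, h x ≤ ∫⁻ x in Ioc 0 L, k x := by
  rw [← setLIntegral_eq_of_support_subset (s := Icc 0 L) (Function.support_subset_iff'.2 h0),
    setLIntegral_congr Ioc_ae_eq_Icc.symm]
  exact setLIntegral_mono' measurableSet_Ioc hk

theorem lintegral_Ioc_rpow {L r : ℝ} (hL : 0 ≤ L) (hr : -1 < r) :
    ∫⁻ x in Ioc 0 L, ENNReal.ofReal (x ^ r) = ENNReal.ofReal (L ^ (r + 1) / (r + 1)) := by
  have hi := intervalIntegral.intervalIntegrable_rpow' (a := 0) (b := L) hr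
  rw [intervalIntegrable_iff_integrableOn_Ioc_of_le hL] at hi
  rw [← ofReal_integral_eq_lintegral_ofReal hi, ← intervalIntegral.integral_of_le hL,
    integral_rpow (Or.inl hr), Real.zero_rpow (by linarith), sub_zero]
  exact (ae_restrict_mem measurableSet_Ioc).mono fun x hx => Real.rpow_nonneg hx.1.le _

theorem lintegral_Ioc_mul_exp_le {a y : ℝ} (ha : 0 < a) (hy : 0 < y) (L : ℝ) :
    ∫⁻ u in Ioc 0 L, ENNReal.ofReal (y * Real.exp (-(a * (u * y)))) ≤ ENNReal.ofReal (1 / a) := by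
  have hn : -(a * y) < 0 := by nlinarith [mul_pos ha hy]
  have hi := (integrableOn_exp_mul_Ioi hn 0).const_mul y
  calc _ ≤ ∫⁻ u in Ioi 0, ENNReal.ofReal (y * Real.exp (-(a * (u * y)))) :=
        lintegral_mono_set Ioc_subset_Ioi_self
    _ = ∫⁻ u in Ioi 0, ENNReal.ofReal (y * Real.exp (-(a * y) * u)) := by
        simp only [show ∀ u, -(a * (u * y)) = -(a * y) * u by intro u; ring]
    _ = ENNReal.ofReal (1 / a) := by
        rw [← ofReal_integral_eq_lintegral_ofReal hi (ae_of_all _ fun u => by positivity),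
          integral_const_mul, integral_exp_mul_Ioi hn]
        congr 1
        simp only [mul_zero, Real.exp_zero]
        field_simp

theorem exp_neg_le_two_mul_rpow {z r : ℝ} (hz : 0 < z) (h0 : 0 ≤ r) (h2 : r ≤ 2) :
    Real.exp (-z) ≤ 2 * z ^ (-r) := by
  have h1 : z ^ r ≤ 2 * Real.exp z := by
    have hq := Real.quadratic_le_exp_of_nonneg hz.le
    rcases le_total z 1 with h | h
    · have := Real.rpow_le_one hz.le h h0
      nlinarith
    · have : z ^ r ≤ z ^ (2 : ℝ) := Real.rpow_le_rpow_of_exponent_le h h2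
      rw [Real.rpow_two] at this
      nlinarith
  have hp : 0 < z ^ r := by positivity
  rw [Real.exp_neg, Real.rpow_neg hz.le, ← div_eq_mul_inv,
    inv_le_comm₀ (by positivity) (by positivity), inv_div, div_le_iff₀ two_pos]
  linarith

theorem exp_neg_mul_le {a u y r : ℝ} (ha : 0 < a) (hu : 0 < u) (hy : 0 < y) (h0 : 0 ≤ r)
    (h2 : r ≤ 2) :
    Real.exp (-(a * (u * y))) ≤ 2 * a ^ (-r) * (u ^ (-r) * y ^ (-r)) := by
  refine (exp_neg_le_two_mul_rpow (by positivity) h0 h2).trans_eq ?_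
  rw [Real.mul_rpow ha.le (by positivity), Real.mul_rpow hu.le hy.le]
  ring

theorem sqrt_mul_add_le {x u : ℝ} (hx : 0 ≤ x) (hu : 0 ≤ u) :
    √(x * (x + u)) ≤ x + x ^ (1 / 2 : ℝ) * u ^ (1 / 2 : ℝ) := by
  rw [← Real.sqrt_eq_rpow, ← Real.sqrt_eq_rpow, Real.sqrt_le_left (by positivity)]
  nlinarith [Real.sq_sqrt hx, Real.sq_sqrt hu, Real.sqrt_nonneg x, Real.sqrt_nonneg u,
    mul_nonneg hx (mul_nonneg (Real.sqrt_nonneg x) (Real.sqrt_nonneg u)),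
    mul_nonneg hx hu, mul_pow √x √u 2]

theorem two_point_integrand_le {a : ℝ} (ha : 0 < a) {x y u v : ℝ} (hx : 0 < x) (hy : 0 < y)
    (hu : 0 < u) (hv : 0 < v) :
    √(x * (x + u)) * √(y * (y + v)) * Real.exp (-(a * (u * y + v * x))) ≤
      y * Real.exp (-(a * (u * y))) * (x * Real.exp (-(a * (v * x)))) +
      8 * a ^ (-2 : ℝ) * (x ^ (-(1 / 4) : ℝ) * y ^ (-(1 / 4) : ℝ) *
        (u ^ (-(3 / 4) : ℝ) * v ^ (-(3 / 4) : ℝ))) +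
      4 * a ^ (-2 : ℝ) * (x ^ (-(1 / 2) : ℝ) * y ^ (-(1 / 2) : ℝ) *
        (u ^ (-(1 / 2) : ℝ) * v ^ (-(1 / 2) : ℝ))) := by
  have key : ∀ r r' p q p' q' : ℝ, 0 ≤ r → r ≤ 2 → 0 ≤ r' → r' ≤ 2 → r + r' = 2 →
      x ^ p * y ^ q * (u ^ p' * v ^ q') *
        (Real.exp (-(a * (u * y))) * Real.exp (-(a * (v * x)))) ≤
      4 * a ^ (-2 : ℝ) * (x ^ (p - r') * y ^ (q - r) * (u ^ (p' - r) * v ^ (q' - r'))) := by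
    intro r r' p q p' q' h1 h2 h3 h4 h5
    have := mul_le_mul (exp_neg_mul_le ha hu hy h1 h2) (exp_neg_mul_le ha hv hx h3 h4)
      (by positivity) (by positivity)
    refine (mul_le_mul_of_nonneg_left this (by positivity)).trans_eq ?_
    rw [show (-2 : ℝ) = -r + -r' by linarith]
    simp only [sub_eq_add_neg, Real.rpow_add hx, Real.rpow_add hy, Real.rpow_add hu,
      Real.rpow_add hv, Real.rpow_add ha]
    ring
  have hB := key (5 / 4) (3 / 4) (1 / 2) 1 (1 / 2) 0 (by norm_num) (by norm_num) (by norm_num)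
    (by norm_num) (by norm_num)
  have hC := key (3 / 4) (5 / 4) 1 (1 / 2) 0 (1 / 2) (by norm_num) (by norm_num) (by norm_num)
    (by norm_num) (by norm_num)
  have hD := key 1 1 (1 / 2) (1 / 2) (1 / 2) (1 / 2) (by norm_num) (by norm_num) (by norm_num)
    (by norm_num) (by norm_num)
  norm_num only [Real.rpow_one, Real.rpow_zero] at hB hC hD
  have he : Real.exp (-(a * (u * y + v * x))) =
      Real.exp (-(a * (u * y))) * Real.exp (-(a * (v * x))) := by
    rw [← Real.exp_add]; ring_nf
  rw [he]
  have hs := mul_le_mul (sqrt_mul_add_le hx.le hu.le) (sqrt_mul_add_le hy.le hv.le)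
    (by positivity) (by positivity)
  refine (mul_le_mul_of_nonneg_right hs (by positivity)).trans ?_
  norm_num only
  linarith

/-- The integrand attached to the pairs `(x₁, x₂)`, `(y₁, y₂)`, extended by zero outside the ordered
region `S ≤ x₁ ≤ x₂ ≤ S'`, `T ≤ y₁ ≤ y₂ ≤ T'`. -/
noncomputable def orderedPairKernel (a S S' T T' : ℝ) : (ℝ × ℝ) × (ℝ × ℝ) → ENNReal :=
  {z | (S ≤ z.1.1 ∧ z.1.1 ≤ z.1.2 ∧ z.1.2 ≤ S') ∧ T ≤ z.2.1 ∧ z.2.1 ≤ z.2.2 ∧ z.2.2 ≤ T'}.indicator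
    fun z => ENNReal.ofReal (√(z.1.1 * z.1.2) * √(z.2.1 * z.2.2) *
      Real.exp (-(a * ((z.1.2 - z.1.1) * z.2.1 + (z.2.2 - z.2.1) * z.1.1))))

theorem measurable_orderedPairKernel (a S S' T T' : ℝ) :
    Measurable (orderedPairKernel a S S' T T') := by
  refine Measurable.indicator (by fun_prop) (measurableSet_setOfPred.2 ?_)
  fun_prop

theorem orderedPairKernel_increments_eq_zero {a S S' T T' x y u v : ℝ}
    (h : ¬(x ∈ Icc 0 (S' - S) ∧ y ∈ Icc 0 (T' - T) ∧ u ∈ Icc 0 (S' - S) ∧ v ∈ Icc 0 (T' - T))) :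
    orderedPairKernel a S S' T T' ((S + x, S + x + u), (T + y, T + y + v)) = 0 := by
  refine indicator_of_notMem (fun hz => h ?_) _
  obtain ⟨⟨h1, h2, h3⟩, h4, h5, h6⟩ := hz
  dsimp only at h1 h2 h3 h4 h5 h6
  simp only [mem_Icc]
  refine ⟨⟨?_, ?_⟩, ⟨?_, ?_⟩, ⟨?_, ?_⟩, ?_, ?_⟩ <;> linarith

theorem orderedPairKernel_increments_le {a S S' T T' x y u v : ℝ} (ha : 0 < a) (hS : 0 ≤ S)
    (hT : 0 ≤ T) (hx : 0 < x) (hy : 0 < y) (hu : 0 < u) (hv : 0 < v) :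
    orderedPairKernel a S S' T T' ((S + x, S + x + u), (T + y, T + y + v)) ≤
      ENNReal.ofReal ((T + y) * Real.exp (-(a * (u * (T + y))))) *
        ENNReal.ofReal ((S + x) * Real.exp (-(a * (v * (S + x))))) +
      ENNReal.ofReal (8 * a ^ (-2 : ℝ)) *
        (ENNReal.ofReal (x ^ (-(1 / 4) : ℝ)) * ENNReal.ofReal (y ^ (-(1 / 4) : ℝ)) *
        (ENNReal.ofReal (u ^ (-(3 / 4) : ℝ)) * ENNReal.ofReal (v ^ (-(3 / 4) : ℝ)))) +
      ENNReal.ofReal (4 * a ^ (-2 : ℝ)) *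
        (ENNReal.ofReal (x ^ (-(1 / 2) : ℝ)) * ENNReal.ofReal (y ^ (-(1 / 2) : ℝ)) *
        (ENNReal.ofReal (u ^ (-(1 / 2) : ℝ)) * ENNReal.ofReal (v ^ (-(1 / 2) : ℝ)))) := by
  refine (indicator_le_self' (fun _ _ => zero_le) _).trans ?_
  have hX : 0 < S + x := by linarith
  have hY : 0 < T + y := by linarith
  have key := two_point_integrand_le ha hX hY hu hv
  have mono : ∀ r : ℝ, 0 ≤ r → (S + x) ^ (-r) * (T + y) ^ (-r) ≤ x ^ (-r) * y ^ (-r) := by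
    intro r hr
    exact mul_le_mul (Real.rpow_le_rpow_of_nonpos hx (by linarith) (by linarith))
      (Real.rpow_le_rpow_of_nonpos hy (by linarith) (by linarith)) (by positivity) (by positivity)
  have m1 := mono (1 / 4) (by norm_num)
  have m2 := mono (1 / 2) (by norm_num)
  simp only [add_sub_cancel_left]
  repeat rw [← ENNReal.ofReal_mul (by positivity)]
  repeat rw [← ENNReal.ofReal_add (by positivity) (by positivity)]
  refine ENNReal.ofReal_le_ofReal (key.trans ?_)
  gcongr

theorem lintegral_const_mul_prod_four {p q : ℝ → ENNReal} (hp : Measurable p)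
    (hq : Measurable q) (K : ENNReal) (A B : Set ℝ) :
    ∫⁻ x in A, ∫⁻ y in B, ∫⁻ u in A, ∫⁻ v in B, K * (p x * p y * (q u * q v)) =
      K * ((∫⁻ x in A, p x) * (∫⁻ y in B, p y) * ((∫⁻ u in A, q u) * ∫⁻ v in B, q v)) := by
  simp (disch := fun_prop) only [lintegral_const_mul, lintegral_mul_const]

theorem lintegral_orderedPairKernel_le {a : ℝ} (ha : 0 < a) :
    ∃ c : ℝ, 0 < c ∧ ∀ S S' T T' : ℝ, 0 ≤ S → S ≤ S' → 0 ≤ T → T ≤ T' →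
      ∫⁻ z, orderedPairKernel a S S' T T' z ≤ ENNReal.ofReal (c * ((S' - S) * (T' - T))) := by
  refine ⟨1 / a * (1 / a) + 8 * a ^ (-2 : ℝ) * (256 / 9) + 4 * a ^ (-2 : ℝ) * 16, by positivity,
    fun S S' T T' hS hS' hT hT' => ?_⟩
  rw [lintegral_pairs_eq_increments (measurable_orderedPairKernel a S S' T T') S T]
  have hL : 0 ≤ S' - S := by linarith
  have hM : 0 ≤ T' - T := by linarith
  have hker := fun x y u v => orderedPairKernel_increments_le (S' := S') (T' := T') (x := x)
    (y := y) (u := u) (v := v) ha hS hT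
  have hzero : ∀ x y u v, ¬(x ∈ Icc 0 (S' - S) ∧ y ∈ Icc 0 (T' - T) ∧ u ∈ Icc 0 (S' - S) ∧
      v ∈ Icc 0 (T' - T)) →
      orderedPairKernel a S S' T T' ((S + x, S + x + u), (T + y, T + y + v)) = 0 :=
    fun x y u v => orderedPairKernel_increments_eq_zero
  generalize S' - S = L at *
  generalize T' - T = M at *
  set p : ℝ → ENNReal := fun x => ENNReal.ofReal (x ^ (-(1 / 4) : ℝ)) with hp
  set q : ℝ → ENNReal := fun x => ENNReal.ofReal (x ^ (-(3 / 4) : ℝ)) with hq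
  set r : ℝ → ENNReal := fun x => ENNReal.ofReal (x ^ (-(1 / 2) : ℝ)) with hr
  have mp : Measurable p := by fun_prop
  have mq : Measurable q := by fun_prop
  have mr : Measurable r := by fun_prop
  set K₁ := ENNReal.ofReal (8 * a ^ (-2 : ℝ))
  set K₂ := ENNReal.ofReal (4 * a ^ (-2 : ℝ))
  have inner : ∀ x ∈ Ioc 0 L, ∀ y ∈ Ioc 0 M,
      ∫⁻ u, ∫⁻ v, orderedPairKernel a S S' T T' ((S + x, S + x + u), (T + y, T + y + v)) ≤
      ENNReal.ofReal (1 / a) * ENNReal.ofReal (1 / a) +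
        (∫⁻ u in Ioc 0 L, ∫⁻ v in Ioc 0 M, K₁ * (p x * p y * (q u * q v))) +
        ∫⁻ u in Ioc 0 L, ∫⁻ v in Ioc 0 M, K₂ * (r x * r y * (r u * r v)) := by
    intro x hx y hy
    calc _ ≤ ∫⁻ u in Ioc 0 L, ∫⁻ v in Ioc 0 M,
          (ENNReal.ofReal ((T + y) * Real.exp (-(a * (u * (T + y))))) *
            ENNReal.ofReal ((S + x) * Real.exp (-(a * (v * (S + x))))) +
          K₁ * (p x * p y * (q u * q v)) + K₂ * (r x * r y * (r u * r v))) := by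
          refine lintegral_le_setLIntegral_Ioc (fun u hu => ?_) fun u hu => ?_
          · rw [lintegral_eq_zero_of_ae_eq_zero]
            exact ae_of_all _ fun v => hzero x y u v (by tauto)
          · exact lintegral_le_setLIntegral_Ioc (fun v hv => hzero x y u v (by tauto))
              fun v hv => hker x y u v hx.1 hy.1 hu.1 hv.1
      _ = (∫⁻ u in Ioc 0 L, ENNReal.ofReal ((T + y) * Real.exp (-(a * (u * (T + y)))))) *
            (∫⁻ v in Ioc 0 M, ENNReal.ofReal ((S + x) * Real.exp (-(a * (v * (S + x)))))) +
          (∫⁻ u in Ioc 0 L, ∫⁻ v in Ioc 0 M, K₁ * (p x * p y * (q u * q v))) +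
          ∫⁻ u in Ioc 0 L, ∫⁻ v in Ioc 0 M, K₂ * (r x * r y * (r u * r v)) := by
          rw [← lintegral_mul_const _ (by fun_prop), ← lintegral_add_left (by fun_prop),
            ← lintegral_add_left]
          · refine lintegral_congr fun u => ?_
            rw [← lintegral_const_mul _ (by fun_prop), ← lintegral_add_left (by fun_prop),
              ← lintegral_add_left (by fun_prop)]
          · simp (disch := fun_prop) only [lintegral_const_mul]
            fun_prop
      _ ≤ _ := by
          gcongr
          · exact lintegral_Ioc_mul_exp_le ha (by linarith [hy.1]) L
          · exact lintegral_Ioc_mul_exp_le ha (by linarith [hx.1]) M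
  calc _ ≤ ∫⁻ x in Ioc 0 L, ∫⁻ y in Ioc 0 M,
        (ENNReal.ofReal (1 / a) * ENNReal.ofReal (1 / a) +
        (∫⁻ u in Ioc 0 L, ∫⁻ v in Ioc 0 M, K₁ * (p x * p y * (q u * q v))) +
        ∫⁻ u in Ioc 0 L, ∫⁻ v in Ioc 0 M, K₂ * (r x * r y * (r u * r v))) := by
        refine lintegral_le_setLIntegral_Ioc (fun x hx => ?_) fun x hx => ?_
        · simp only [fun y u v => hzero x y u v (by tauto), lintegral_zero]
        · refine lintegral_le_setLIntegral_Ioc (fun y hy => ?_) fun y hy => inner x hx y hy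
          simp only [fun u v => hzero x y u v (by tauto), lintegral_zero]
    _ = (∫⁻ x in Ioc 0 L, ∫⁻ y in Ioc 0 M, ENNReal.ofReal (1 / a) * ENNReal.ofReal (1 / a)) +
        (∫⁻ x in Ioc 0 L, ∫⁻ y in Ioc 0 M, ∫⁻ u in Ioc 0 L, ∫⁻ v in Ioc 0 M,
          K₁ * (p x * p y * (q u * q v))) +
        ∫⁻ x in Ioc 0 L, ∫⁻ y in Ioc 0 M, ∫⁻ u in Ioc 0 L, ∫⁻ v in Ioc 0 M,
          K₂ * (r x * r y * (r u * r v)) := by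
        simp (disch := fun_prop) only [lintegral_const_mul, lintegral_mul_const,
          lintegral_add_left]
    _ = _ := by
        rw [lintegral_const_mul_prod_four mp mq, lintegral_const_mul_prod_four mr mr]
        simp only [hp, hq, hr]
        simp only [lintegral_Ioc_rpow hL, lintegral_Ioc_rpow hM, lintegral_const,
          Measure.restrict_apply_univ, Real.volume_Ioc, sub_zero,
          show (-1 : ℝ) < -(1 / 4) by norm_num, show (-1 : ℝ) < -(3 / 4) by norm_num,
          show (-1 : ℝ) < -(1 / 2) by norm_num]
        norm_num only
        repeat rw [← ENNReal.ofReal_mul (by positivity)]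
        repeat rw [← ENNReal.ofReal_add (by positivity) (by positivity)]
        congr 1
        have e1 : ∀ z : ℝ, 0 ≤ z → z ^ (3 / 4 : ℝ) * z ^ (1 / 4 : ℝ) = z := fun z hz => by
          rw [← Real.rpow_add_of_nonneg hz (by norm_num) (by norm_num)]; norm_num
        have e2 : ∀ z : ℝ, 0 ≤ z → z ^ (1 / 2 : ℝ) * z ^ (1 / 2 : ℝ) = z := fun z hz => by
          rw [← Real.rpow_add_of_nonneg hz (by norm_num) (by norm_num)]; norm_num
        have a1 := congrArg₂ (· * ·) (e1 L hL) (e1 M hM)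
        have a2 := congrArg₂ (· * ·) (e2 L hL) (e2 M hM)
        norm_num only at a1 a2 ⊢
        linear_combination (a ^ (-2 : ℝ) * 8 * (256 / 9)) * a1 + (a ^ (-2 : ℝ) * 4 * 16) * a2

/-- The key integral estimate in the proof of tightness (case i) of Figure 2): the eightfold
integral over the ordered simplex region is bounded by `C (s'-s)² (t'-t)²`, uniformly in
`ε > 0`, for a constant `C` depending only on `a > 0`. -/
theorem ordered_simplex_integral_bound (a : ℝ) (ha : 0 < a) :
    ∃ C : ℝ, 0 < C ∧
      ∀ s s' t t' ε : ℝ, 0 ≤ s → s < s' → 0 ≤ t → t < t' → 0 < ε →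
        ε ^ 4 *
          ∫ p in {p : (Fin 4 → ℝ) × (Fin 4 → ℝ) |
              s / ε ≤ p.1 0 ∧ p.1 0 ≤ p.1 1 ∧ p.1 1 ≤ p.1 2 ∧ p.1 2 ≤ p.1 3 ∧
                p.1 3 ≤ s' / ε ∧
              t / ε ≤ p.2 0 ∧ p.2 0 ≤ p.2 1 ∧ p.2 1 ≤ p.2 2 ∧ p.2 2 ≤ p.2 3 ∧
                p.2 3 ≤ t' / ε},
            Real.sqrt (p.1 0 * p.1 1 * p.1 2 * p.1 3) *
              Real.sqrt (p.2 0 * p.2 1 * p.2 2 * p.2 3) *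
              Real.exp (-(a * ((p.1 3 - p.1 2) * p.2 2 + (p.2 3 - p.2 2) * p.1 2 +
                (p.1 1 - p.1 0) * p.2 0 + (p.2 1 - p.2 0) * p.1 0)))
          ≤ C * (s' - s) ^ 2 * (t' - t) ^ 2 := by
  obtain ⟨c, hc, hbound⟩ := lintegral_orderedPairKernel_le ha
  refine ⟨c ^ 2, by positivity, fun s s' t t' ε hs hs' ht ht' hε => ?_⟩
  have hJ := hbound (s / ε) (s' / ε) (t / ε) (t' / ε) (by positivity) (by gcongr)
    (by positivity) (by gcongr)
  have hS : 0 ≤ s / ε := by positivity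
  have hT : 0 ≤ t / ε := by positivity
  have hd : 0 ≤ c * ((s' / ε - s / ε) * (t' / ε - t / ε)) := by
    rw [← sub_div, ← sub_div]
    have := sub_pos.2 hs'
    have := sub_pos.2 ht'
    positivity
  have hgoal : ε ^ 4 * (c * ((s' / ε - s / ε) * (t' / ε - t / ε))) ^ 2 =
      c ^ 2 * (s' - s) ^ 2 * (t' - t) ^ 2 := by
    field_simp
  rw [← hgoal]
  refine mul_le_mul_of_nonneg_left ?_ (by positivity)
  rw [integral_eq_lintegral_of_nonneg_ae (ae_of_all _ fun p => by positivity)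
    (Continuous.aestronglyMeasurable (by fun_prop))]
  refine ENNReal.toReal_le_of_le_ofReal (by positivity) ?_
  rw [sq, ENNReal.ofReal_mul hd]
  refine le_trans ?_ (mul_le_mul' hJ hJ)
  rw [← lintegral_finFour_prod_mul (measurable_orderedPairKernel ..), ← lintegral_indicator]
  · refine lintegral_mono fun p => ?_
    refine indicator_apply_le' (fun hp => ?_) fun _ => zero_le
    obtain ⟨h1, h2, h3, h4, h5, h6, h7, h8, h9, h10⟩ := hp
    unfold orderedPairKernel
    rw [indicator_of_mem, indicator_of_mem, ← ENNReal.ofReal_mul (by positivity)]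
    · refine ENNReal.ofReal_le_ofReal (le_of_eq ?_)
      rw [mul_assoc (p.1 0 * p.1 1), mul_assoc (p.2 0 * p.2 1),
        Real.sqrt_mul (mul_nonneg (by linarith) (by linarith)),
        Real.sqrt_mul (mul_nonneg (by linarith) (by linarith)),
        mul_mul_mul_comm (_ * _) (Real.exp _), ← Real.exp_add]
      ring_nf
    · exact ⟨⟨by linarith, h4, h5⟩, by linarith, h9, h10⟩
    · exact ⟨⟨h1, h2, by linarith⟩, h6, h7, by linarith⟩
  · refine measurableSet_setOfPred.2 ?_
    fun_prop
end

section
/- Let a > 0 and b ∈ ℝ. Then lim_{u→∞} √u · ∫₀^u (1/v) ∫₀^v √z · exp(−(a+ib)(u−z)) dz dv = 1/(a+ib)², where the limit is taken in ℂ. -/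
open MeasureTheory Filter Set Topology intervalIntegral

/-- If `w u * f (u - t) → L` for every `t`, with `‖w u * f (u - t)‖ ≤ C (1 + t)` for `0 < t < u`, then
convolving `f` with an exponentially decaying kernel multiplies the weighted limit by `1 / c`. -/
theorem tendsto_mul_integral_mul_exp {c : ℂ} (hc : 0 < c.re) {f w : ℝ → ℂ} (hf : Measurable f)
    {C : ℝ} {L : ℂ} (hbound : ∀ u t : ℝ, 0 < t → t < u → ‖w u * f (u - t)‖ ≤ C * (1 + t))
    (hlim : ∀ t : ℝ, 0 < t → Tendsto (fun u => w u * f (u - t)) atTop (𝓝 L)) :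
    Tendsto (fun u : ℝ => w u * ∫ v in (0 : ℝ)..u, f v * Complex.exp (-c * ((u : ℂ) - (v : ℂ))))
      atTop (𝓝 (L / c)) := by
  have hint : ∫ t in Ioi (0 : ℝ), L * Complex.exp (-c * t) = L / c := by
    rw [MeasureTheory.integral_const_mul, integral_exp_mul_complex_Ioi (by simpa using hc)]
    simp [div_eq_mul_inv]
  have hexp : IntegrableOn (fun t : ℝ => C * (1 + t) * Real.exp (-c.re * t)) (Ioi 0) := by
    have h0 : IntegrableOn (fun t : ℝ => Real.exp (-c.re * t)) (Ioi 0) :=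
      integrableOn_exp_mul_Ioi (by linarith) 0
    have h1 : IntegrableOn (fun t : ℝ => t * Real.exp (-c.re * t)) (Ioi 0) := by
      have := integrableOn_rpow_mul_exp_neg_mul_rpow (s := 1) (p := 1) (b := c.re)
        (by norm_num) (by norm_num) hc
      simpa using this
    refine ((h0.add h1).const_mul C).congr (ae_of_all _ fun t => ?_)
    simp only [Pi.add_apply]
    ring
  rw [← hint]
  have key : Tendsto (fun u : ℝ => ∫ t in Ioi (0 : ℝ),
      (Iio u).indicator (fun t => w u * f (u - t) * Complex.exp (-c * t)) t) atTop
      (𝓝 (∫ t in Ioi (0 : ℝ), L * Complex.exp (-c * t))) := by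
    refine tendsto_integral_filter_of_dominated_convergence _
      (Eventually.of_forall fun u => ?_) (Eventually.of_forall fun u => ?_) hexp ?_
    · refine (Measurable.indicator ?_ measurableSet_Iio).aestronglyMeasurable
      exact ((hf.comp (measurable_const.sub measurable_id)).const_mul _).mul
        (by fun_prop : Continuous fun t : ℝ => Complex.exp (-c * t)).measurable
    · refine (ae_restrict_iff' measurableSet_Ioi).2 (ae_of_all _ fun t ht => ?_)
      by_cases htu : t < u
      · rw [indicator_of_mem (show t ∈ Iio u from htu), norm_mul, Complex.norm_exp]
        have : (-c * (t : ℂ)).re = -c.re * t := by simp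
        rw [this]
        gcongr
        exact hbound u t ht htu
      · rw [indicator_of_notMem (show t ∉ Iio u from htu), norm_zero]
        have ht0 : 0 < t := ht
        have hC : 0 ≤ C * (1 + t) :=
          (norm_nonneg _).trans (hbound (t + 1) t ht0 (by linarith))
        positivity
    · refine (ae_restrict_iff' measurableSet_Ioi).2 (ae_of_all _ fun t ht => ?_)
      refine ((hlim t ht).mul_const (Complex.exp (-c * t))).congr' ?_
      filter_upwards [eventually_gt_atTop t] with u hu
      rw [indicator_of_mem (show t ∈ Iio u from hu)]
  refine key.congr' ?_
  filter_upwards [eventually_gt_atTop 0] with u hu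
  have hsub : ∫ v in (0 : ℝ)..u, f v * Complex.exp (-c * ((u : ℂ) - (v : ℂ))) =
      ∫ t in (0 : ℝ)..u, f (u - t) * Complex.exp (-c * t) := by
    have := intervalIntegral.integral_comp_sub_left (a := 0) (b := u)
      (fun v : ℝ => f v * Complex.exp (-c * ((u : ℂ) - (v : ℂ)))) u
    simpa using this.symm
  rw [hsub, MeasureTheory.setIntegral_indicator measurableSet_Iio, Ioi_inter_Iio,
    ← integral_Ioc_eq_integral_Ioo, ← intervalIntegral.integral_of_le hu.le,
    ← intervalIntegral.integral_const_mul]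
  simp only [mul_assoc]

theorem tendsto_sqrt_sub_div_sqrt (t : ℝ) :
    Tendsto (fun u : ℝ => √(u - t) / √u) atTop (𝓝 1) := by
  have h : Tendsto (fun u : ℝ => √(1 - t / u)) atTop (𝓝 1) := by
    have h0 : Tendsto (fun u : ℝ => t / u) atTop (𝓝 0) := tendsto_const_nhds.div_atTop tendsto_id
    simpa using (h0.const_sub 1).sqrt
  refine h.congr' ?_
  filter_upwards [eventually_gt_atTop 0] with u hu
  rw [← Real.sqrt_div' _ hu.le, sub_div, div_self hu.ne']

theorem norm_sqrt_mul_exp (c : ℂ) (v z : ℝ) :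
    ‖(√z : ℂ) * Complex.exp (-c * ((v : ℂ) - (z : ℂ)))‖ = √z * Real.exp (-c.re * (v - z)) := by
  rw [norm_mul, Complex.norm_exp, Complex.norm_real, Real.norm_of_nonneg (Real.sqrt_nonneg z)]
  simp

theorem norm_integral_sqrt_mul_exp_le_mul_sqrt {c : ℂ} (hc : 0 < c.re) {v : ℝ} (hv : 0 < v) :
    ‖∫ z in (0 : ℝ)..v, (√z : ℂ) * Complex.exp (-c * ((v : ℂ) - (z : ℂ)))‖ ≤ √v * v := by
  have := intervalIntegral.norm_integral_le_of_norm_le_const (a := 0) (b := v) (C := √v)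
    (f := fun z : ℝ => (√z : ℂ) * Complex.exp (-c * ((v : ℂ) - (z : ℂ)))) fun z hz => by
      rw [uIoc_of_le hv.le] at hz
      rw [norm_sqrt_mul_exp]
      have h1 : Real.exp (-c.re * (v - z)) ≤ 1 := by
        rw [Real.exp_le_one_iff]
        nlinarith [hz.2]
      calc _ ≤ √z * 1 := by gcongr
        _ ≤ √v := by rw [mul_one]; exact Real.sqrt_le_sqrt hz.2
  simpa [abs_of_pos hv] using this

theorem norm_integral_sqrt_mul_exp_le_sqrt_div {c : ℂ} (hc : 0 < c.re) {v : ℝ} (hv : 0 < v) :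
    ‖∫ z in (0 : ℝ)..v, (√z : ℂ) * Complex.exp (-c * ((v : ℂ) - (z : ℂ)))‖ ≤ √v / c.re := by
  have hderiv : ∀ z : ℝ, HasDerivAt (fun z : ℝ => √v / c.re * Real.exp (-c.re * (v - z)))
      (√v * Real.exp (-c.re * (v - z))) z := fun z => by
    refine (((((hasDerivAt_id' z).const_sub v).const_mul (-c.re)).exp).const_mul
      (√v / c.re)).congr_deriv ?_
    field_simp
  have hcont : Continuous fun z : ℝ => √v * Real.exp (-c.re * (v - z)) := by fun_prop
  have hFTC := intervalIntegral.integral_eq_sub_of_hasDerivAt (a := 0) (b := v)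
    (fun z _ => hderiv z) (hcont.intervalIntegrable _ _)
  calc _ ≤ ∫ z in (0 : ℝ)..v, √v * Real.exp (-c.re * (v - z)) := by
        refine intervalIntegral.norm_integral_le_of_norm_le hv.le (ae_of_all _ fun z hz => ?_)
          (hcont.intervalIntegrable _ _)
        rw [norm_sqrt_mul_exp]
        gcongr
        exact hz.2
    _ ≤ √v / c.re := by
        rw [hFTC]
        have : 0 ≤ √v / c.re * Real.exp (-c.re * (v - 0)) := by positivity
        simp only [sub_self, mul_zero, Real.exp_zero, mul_one]
        linarith

theorem continuous_integral_sqrt_mul_exp (c : ℂ) :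
    Continuous fun v : ℝ =>
      ∫ z in (0 : ℝ)..v, (√z : ℂ) * Complex.exp (-c * ((v : ℂ) - (z : ℂ))) := by
  have h : (fun v : ℝ => ∫ z in (0 : ℝ)..v, (√z : ℂ) * Complex.exp (-c * ((v : ℂ) - (z : ℂ)))) =
      fun v : ℝ => Complex.exp (-c * v) * ∫ z in (0 : ℝ)..v, (√z : ℂ) * Complex.exp (c * z) := by
    funext v
    rw [← intervalIntegral.integral_const_mul]
    congr 1 with z
    rw [mul_left_comm, ← Complex.exp_add]
    congr 2
    ring
  have hcont : Continuous fun z : ℝ => (√z : ℂ) * Complex.exp (c * z) := by fun_prop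
  rw [h]
  exact (by fun_prop : Continuous fun v : ℝ => Complex.exp (-c * v)).mul
    (intervalIntegral.continuous_primitive (fun x y => hcont.intervalIntegrable x y) 0)

theorem tendsto_inv_sqrt_mul_integral_sqrt_mul_exp {c : ℂ} (hc : 0 < c.re) :
    Tendsto (fun v : ℝ => ((√v)⁻¹ : ℂ) *
        ∫ z in (0 : ℝ)..v, (√z : ℂ) * Complex.exp (-c * ((v : ℂ) - (z : ℂ))))
      atTop (𝓝 (1 / c)) := by
  refine tendsto_mul_integral_mul_exp (f := fun z => (√z : ℂ)) (w := fun v => ((√v)⁻¹ : ℂ)) (C := 1)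
    hc (by fun_prop) (fun u t ht htu => ?_) fun t _ => ?_
  · rw [norm_mul, norm_inv, Complex.norm_real, Complex.norm_real,
      Real.norm_of_nonneg (Real.sqrt_nonneg _), Real.norm_of_nonneg (Real.sqrt_nonneg _),
      inv_mul_le_iff₀ (Real.sqrt_pos.2 (ht.trans htu))]
    have : √(u - t) ≤ √u := Real.sqrt_le_sqrt (by linarith)
    nlinarith [Real.sqrt_nonneg u]
  · have h := (Complex.continuous_ofReal.tendsto 1).comp (tendsto_sqrt_sub_div_sqrt t)
    rw [Complex.ofReal_one] at h
    refine h.congr fun u => ?_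
    simp [div_eq_inv_mul]

/-- The limit of `B_u` in the proof of Lemma 4.5:
`√u ∫₀^u (1/v) ∫₀^v √z exp(-(a+ib)(u-z)) dz dv → 1/(a+ib)²` as `u → ∞`, for `a > 0`. -/
theorem sqrt_mul_double_integral_tendsto (a b : ℝ) (ha : 0 < a) :
    Tendsto
      (fun u : ℝ => (Real.sqrt u : ℂ) *
        ∫ v in (0 : ℝ)..u, ((v : ℂ))⁻¹ *
          ∫ z in (0 : ℝ)..v,
            (Real.sqrt z : ℂ) * Complex.exp (-((a : ℂ) + (b : ℂ) * Complex.I) * ((u : ℂ) - (z : ℂ))))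
      atTop (𝓝 (1 / ((a : ℂ) + (b : ℂ) * Complex.I) ^ 2)) := by
  have hre : 0 < ((a : ℂ) + (b : ℂ) * Complex.I).re := by simpa using ha
  generalize (a : ℂ) + (b : ℂ) * Complex.I = c at hre ⊢
  set F : ℝ → ℂ := fun v =>
    ∫ z in (0 : ℝ)..v, (√z : ℂ) * Complex.exp (-c * ((v : ℂ) - (z : ℂ))) with hF
  have hlim : Tendsto (fun v : ℝ => ((√v)⁻¹ : ℂ) * F v) atTop (𝓝 (1 / c)) :=
    tendsto_inv_sqrt_mul_integral_sqrt_mul_exp hre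
  have hbound : ∀ v : ℝ, 0 < v → (1 + √v) * ‖(v : ℂ)⁻¹ * F v‖ ≤ 1 + 2 / c.re := fun v hv => by
    have h1 : ‖F v‖ ≤ √v * v := norm_integral_sqrt_mul_exp_le_mul_sqrt hre hv
    have h2 : ‖F v‖ ≤ √v / c.re := norm_integral_sqrt_mul_exp_le_sqrt_div hre hv
    have hs := Real.sqrt_pos.2 hv
    have hsq : √v * √v = v := Real.mul_self_sqrt hv.le
    rw [norm_mul, norm_inv, Complex.norm_real, Real.norm_of_nonneg hv.le]
    have h3 : v⁻¹ * ‖F v‖ ≤ √v := by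
      rw [inv_mul_le_iff₀ hv]
      linarith
    have h4 : √v * (v⁻¹ * ‖F v‖) ≤ 1 / c.re := by
      calc √v * (v⁻¹ * ‖F v‖) ≤ √v * (v⁻¹ * (√v / c.re)) := by gcongr
        _ = (√v * √v) * v⁻¹ / c.re := by ring
        _ = 1 / c.re := by rw [hsq, mul_inv_cancel₀ hv.ne']
    have h5 : 2 / c.re = 1 / c.re + 1 / c.re := by ring
    have h6 : 0 < 1 / c.re := by positivity
    have h7 : 0 ≤ v⁻¹ * ‖F v‖ := by positivity
    rcases le_total (√v) 1 with h | h <;> nlinarith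
  have hmain := tendsto_mul_integral_mul_exp (f := fun v => (v : ℂ)⁻¹ * F v)
    (w := fun u => (√u : ℂ)) (C := 1 + 2 / c.re) (L := 1 / c) hre
    (Complex.measurable_ofReal.inv.mul (continuous_integral_sqrt_mul_exp c).measurable)
    (fun u t ht htu => ?_) fun t _ => ?_
  · rw [show 1 / c ^ 2 = 1 / c / c by rw [div_div, sq]]
    refine hmain.congr fun u => ?_
    congr 2 with v
    rw [mul_assoc, hF, ← intervalIntegral.integral_mul_const]
    congr 2 with z
    rw [mul_assoc, ← Complex.exp_add]
    congr 2
    ring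
  · have hv : 0 < u - t := by linarith
    have hsqrt : √u ≤ (1 + t) * (1 + √(u - t)) := by
      rw [Real.sqrt_le_left (by positivity)]
      have hsq : √(u - t) ^ 2 = u - t := Real.sq_sqrt hv.le
      have hs := Real.sqrt_nonneg (u - t)
      nlinarith [mul_nonneg ht.le hs, mul_nonneg ht.le hv.le, mul_nonneg (sq_nonneg t) hs,
        mul_nonneg (sq_nonneg t) hv.le]
    rw [norm_mul, Complex.norm_real, Real.norm_of_nonneg (Real.sqrt_nonneg _)]
    calc √u * ‖((u - t : ℝ) : ℂ)⁻¹ * F (u - t)‖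
        ≤ (1 + t) * (1 + √(u - t)) * ‖((u - t : ℝ) : ℂ)⁻¹ * F (u - t)‖ := by gcongr
      _ = (1 + t) * ((1 + √(u - t)) * ‖((u - t : ℝ) : ℂ)⁻¹ * F (u - t)‖) := by ring
      _ ≤ (1 + t) * (1 + 2 / c.re) := by
        gcongr
        exact hbound _ hv
      _ = _ := mul_comm _ _
  · have h := (Complex.continuous_ofReal.tendsto _).comp
      ((tendsto_sqrt_sub_div_sqrt t).inv₀ one_ne_zero)
    have h' := h.mul (hlim.comp (tendsto_atTop_add_const_right atTop (-t) tendsto_id))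
    rw [inv_one, Complex.ofReal_one, one_mul] at h'
    refine h'.congr' ?_
    filter_upwards [eventually_gt_atTop t] with u hu
    have hv : 0 < u - t := by linarith
    have hs : ((√(u - t) : ℝ) : ℂ) ≠ 0 := by exact_mod_cast (Real.sqrt_pos.2 hv).ne'
    have hsq : ((u - t : ℝ) : ℂ) = (√(u - t) : ℂ) * (√(u - t) : ℂ) := by
      exact_mod_cast (Real.mul_self_sqrt hv.le).symm
    simp only [Function.comp_apply, id_eq, ← sub_eq_add_neg, inv_div, Complex.ofReal_div]
    rw [hsq]
    field_simp
end

section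
/- Let a > 0 and b ∈ ℝ. Then lim_{u→∞} u² ∫₀¹ ∫₀¹ √y · exp(a(2xy − y − x)u) · cos(b(y − x)u) dx dy = 1/(a² + b²). -/
open MeasureTheory Filter Set Topology

lemma integrableOn_exp_neg_mul_add {c : ℝ} (hc : 0 < c) :
    IntegrableOn (fun p : ℝ × ℝ => Real.exp (-c * (p.1 + p.2))) (Ici 0 ×ˢ Ici 0) := by
  have h : IntegrableOn (fun x : ℝ => Real.exp (-c * x)) (Ici 0) :=
    (integrableOn_Ici_iff_integrableOn_Ioi (by simp)).2
      (integrableOn_exp_mul_Ioi (by linarith) 0)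
  have h2 := Integrable.mul_prod h h
  rw [Measure.prod_restrict] at h2
  refine h2.congr (ae_of_all _ fun p => ?_)
  simp only [← Real.exp_add]
  ring_nf

lemma integral_exp_mul_cos_quadrant {a : ℝ} (b : ℝ) (ha : 0 < a) :
    ∫ p in Ici (0 : ℝ) ×ˢ Ici (0 : ℝ),
      Real.exp (-a * (p.1 + p.2)) * Real.cos (b * (p.2 - p.1)) = 1 / (a ^ 2 + b ^ 2) := by
  have hexp : ∀ z : ℂ, z.re < 0 → ∫ x in Ici (0 : ℝ), Complex.exp (z * x) = -1 / z := by
    intro z hz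
    rw [integral_Ici_eq_integral_Ioi, integral_exp_mul_complex_Ioi hz]
    simp
  have hprod := setIntegral_prod_mul (μ := (volume : Measure ℝ)) (ν := (volume : Measure ℝ))
    (fun x : ℝ => Complex.exp ((-a - b * Complex.I) * x))
    (fun y : ℝ => Complex.exp ((-a + b * Complex.I) * y)) (Ici 0) (Ici 0)
  rw [hexp _ (by simpa using ha), hexp _ (by simpa using ha)] at hprod
  have hfun : ∀ p : ℝ × ℝ,
      Complex.exp ((-a - b * Complex.I) * p.1) * Complex.exp ((-a + b * Complex.I) * p.2) =
        Complex.exp (((-a * (p.1 + p.2) : ℝ) : ℂ) + ((b * (p.2 - p.1) : ℝ) : ℂ) * Complex.I) := by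
    intro p
    rw [← Complex.exp_add]
    push_cast
    ring_nf
  simp only [hfun] at hprod
  have hint : IntegrableOn (fun p : ℝ × ℝ =>
      Complex.exp (((-a * (p.1 + p.2) : ℝ) : ℂ) + ((b * (p.2 - p.1) : ℝ) : ℂ) * Complex.I))
      (Ici 0 ×ˢ Ici 0) := by
    refine (integrableOn_exp_neg_mul_add ha).mono' ?_ (ae_of_all _ fun p => ?_)
    · exact Continuous.aestronglyMeasurable (by fun_prop)
    · rw [Complex.norm_exp]
      simp
  have hre := integral_re hint
  rw [← Measure.volume_eq_prod] at hprod
  simp only [RCLike.re_to_complex] at hre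
  rw [hprod] at hre
  have hval : -1 / (-(a : ℂ) - b * Complex.I) * (-1 / (-(a : ℂ) + b * Complex.I)) =
      ((1 / (a ^ 2 + b ^ 2) : ℝ) : ℂ) := by
    rw [div_mul_div_comm]
    push_cast
    congr 1
    · norm_num
    · linear_combination (-(b : ℂ) ^ 2) * Complex.I_sq
  rw [hval, Complex.ofReal_re] at hre
  rw [← hre]
  refine integral_congr_ae (ae_of_all _ fun p => ?_)
  simp only [Complex.exp_re, Complex.add_re, Complex.add_im, Complex.ofReal_re, Complex.ofReal_im,
    Complex.mul_re, Complex.mul_im, Complex.I_re, Complex.I_im]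
  simp

/-- Laplace-type asymptotics at the corner of a right triangle, whose hypotenuse may or may not
belong to the domain `T` of integration. -/
lemma tendsto_sq_mul_setIntegral_triangle {a : ℝ} (b : ℝ) (ha : 0 < a) {T : Set (ℝ × ℝ)}
    (hT : MeasurableSet T) (hsub : ∀ p ∈ T, 0 ≤ p.1 ∧ 0 ≤ p.2 ∧ p.1 + p.2 ≤ 1)
    (hsup : ∀ p : ℝ × ℝ, 0 ≤ p.1 → 0 ≤ p.2 → p.1 + p.2 < 1 → p ∈ T)
    {h : ℝ × ℝ → ℝ} (hcont : Continuous h) (hbound : ∀ p ∈ T, |h p| ≤ 1) :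
    Tendsto (fun u : ℝ => u ^ 2 * ∫ p in T,
        h p * Real.exp (a * (2 * p.1 * p.2 - p.2 - p.1) * u) * Real.cos (b * (p.2 - p.1) * u))
      atTop (𝓝 (h 0 * (1 / (a ^ 2 + b ^ 2)))) := by
  set F : ℝ → ℝ × ℝ → ℝ := fun u => T.indicator fun p =>
    h p * Real.exp (a * (2 * p.1 * p.2 - p.2 - p.1) * u) * Real.cos (b * (p.2 - p.1) * u) with hF
  have hFmeas : ∀ u, Measurable (F u) := fun u =>
    Measurable.indicator (Continuous.measurable (by fun_prop)) hT
  have hscale : (fun u : ℝ => ∫ p, F u (u⁻¹ • p)) =ᶠ[atTop] (fun u : ℝ => u ^ 2 * ∫ p in T,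
      h p * Real.exp (a * (2 * p.1 * p.2 - p.2 - p.1) * u) *
        Real.cos (b * (p.2 - p.1) * u)) := by
    filter_upwards [eventually_gt_atTop 0] with u hu
    rw [Measure.integral_comp_smul volume (F u) u⁻¹, hF, integral_indicator hT]
    simp [Module.finrank_prod]
  refine Tendsto.congr' hscale ?_
  rw [← integral_exp_mul_cos_quadrant b ha, ← integral_const_mul,
    ← integral_indicator (measurableSet_Ici.prod measurableSet_Ici)]
  refine tendsto_integral_filter_of_dominated_convergence
    ((Ici 0 ×ˢ Ici 0).indicator fun p : ℝ × ℝ => Real.exp (-(a / 2) * (p.1 + p.2))) ?_ ?_ ?_ ?_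
  · exact Eventually.of_forall fun u =>
      ((hFmeas u).comp (measurable_const_smul u⁻¹)).aestronglyMeasurable
  · filter_upwards [eventually_gt_atTop 0] with u hu
    refine ae_of_all _ fun p => ?_
    by_cases hp : u⁻¹ • p ∈ T
    · obtain ⟨h1, h2, h3⟩ := hsub _ hp
      obtain ⟨q, rfl⟩ : ∃ q : ℝ × ℝ, p = u • q := ⟨u⁻¹ • p, by simp [smul_smul, hu.ne']⟩
      rw [inv_smul_smul₀ hu.ne'] at *
      have hq : u • q ∈ Ici (0 : ℝ) ×ˢ Ici (0 : ℝ) :=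
        ⟨mul_nonneg hu.le h1, mul_nonneg hu.le h2⟩
      rw [indicator_of_mem hq, hF]
      simp only [indicator_of_mem hp, Real.norm_eq_abs, abs_mul, Real.abs_exp, Prod.smul_fst,
        Prod.smul_snd, smul_eq_mul]
      have hexp : Real.exp (a * (2 * q.1 * q.2 - q.2 - q.1) * u) ≤
          Real.exp (-(a / 2) * (u * q.1 + u * q.2)) := by
        apply Real.exp_le_exp.2
        have : 2 * q.1 * q.2 - q.2 - q.1 ≤ -(1 / 2) * (q.1 + q.2) := by
          nlinarith [sq_nonneg (q.1 - q.2)]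
        calc _ = (a * u) * (2 * q.1 * q.2 - q.2 - q.1) := by ring
          _ ≤ (a * u) * (-(1 / 2) * (q.1 + q.2)) := by gcongr
          _ = _ := by ring
      calc _ ≤ 1 * Real.exp (a * (2 * q.1 * q.2 - q.2 - q.1) * u) * 1 := by
            gcongr
            · exact hbound _ hp
            · exact Real.abs_cos_le_one _
        _ ≤ _ := by simpa using hexp
    · rw [hF]
      simp only [indicator_of_notMem hp, norm_zero]
      exact indicator_nonneg (fun _ _ => (Real.exp_pos _).le) _
  · exact (integrable_indicator_iff (measurableSet_Ici.prod measurableSet_Ici)).2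
      (integrableOn_exp_neg_mul_add (half_pos ha))
  · refine ae_of_all _ fun p => ?_
    by_cases hp : p ∈ Ici (0 : ℝ) ×ˢ Ici (0 : ℝ)
    · rw [indicator_of_mem hp]
      have hinv : Tendsto (fun u : ℝ => u⁻¹) atTop (𝓝 0) := tendsto_inv_atTop_zero
      have hlim : Tendsto (fun u : ℝ => h (u⁻¹ • p) *
          Real.exp (a * (2 * p.1 * p.2 * u⁻¹ - p.2 - p.1)) * Real.cos (b * (p.2 - p.1))) atTop
          (𝓝 (h 0 * (Real.exp (-a * (p.1 + p.2)) * Real.cos (b * (p.2 - p.1))))) := by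
        have hc : Continuous fun v : ℝ => h (v • p) *
          Real.exp (a * (2 * p.1 * p.2 * v - p.2 - p.1)) * Real.cos (b * (p.2 - p.1)) := by
          fun_prop
        have := (hc.tendsto 0).comp hinv
        have hzero : a * (2 * p.1 * p.2 * 0 - p.2 - p.1) = -a * (p.1 + p.2) := by ring
        rwa [zero_smul, hzero, mul_assoc (h 0)] at this
      refine hlim.congr' ?_
      filter_upwards [eventually_gt_atTop 0, eventually_gt_atTop (p.1 + p.2)] with u hu hup
      have hmem : u⁻¹ • p ∈ T := by
        refine hsup _ (mul_nonneg (inv_nonneg.2 hu.le) hp.1)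
          (mul_nonneg (inv_nonneg.2 hu.le) hp.2) ?_
        simp only [Prod.smul_fst, Prod.smul_snd, smul_eq_mul]
        rw [← mul_add, inv_mul_lt_iff₀ hu]
        simpa using hup
      simp only [hF, indicator_of_mem hmem, Prod.smul_fst, Prod.smul_snd, smul_eq_mul]
      have hexp : a * (2 * (u⁻¹ * p.1) * (u⁻¹ * p.2) - u⁻¹ * p.2 - u⁻¹ * p.1) * u =
          a * (2 * p.1 * p.2 * u⁻¹ - p.2 - p.1) := by
        field_simp
      have hcos : b * (u⁻¹ * p.2 - u⁻¹ * p.1) * u = b * (p.2 - p.1) := by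
        field_simp
      rw [hexp, hcos]
    · rw [indicator_of_notMem hp]
      refine tendsto_const_nhds.congr' ?_
      filter_upwards [eventually_gt_atTop 0] with u hu
      have hmem : u⁻¹ • p ∉ T := by
        intro hmem
        obtain ⟨h1, h2, -⟩ := hsub _ hmem
        exact hp ⟨nonneg_of_mul_nonneg_right h1 (inv_pos.2 hu),
          nonneg_of_mul_nonneg_right h2 (inv_pos.2 hu)⟩
      simp only [hF, indicator_of_notMem hmem]

/-- The limit of `C̃_u` in the proof of Lemma 4.5:
`u² ∫₀¹ ∫₀¹ √y exp(a(2xy - y - x) u) cos(b(y - x) u) dx dy → 1/(a² + b²)` as `u → ∞`. -/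
theorem limit_tilde_C (a b : ℝ) (ha : 0 < a) :
    Tendsto
      (fun u : ℝ => u ^ 2 *
        ∫ p in Set.Icc (0 : ℝ) 1 ×ˢ Set.Icc (0 : ℝ) 1,
          Real.sqrt p.2 * Real.exp (a * (2 * p.1 * p.2 - p.2 - p.1) * u) *
            Real.cos (b * (p.2 - p.1) * u))
      atTop (𝓝 (1 / (a ^ 2 + b ^ 2))) := by
  set A : Set (ℝ × ℝ) := Icc (0 : ℝ) 1 ×ˢ Icc (0 : ℝ) 1 with hA
  have hAm : MeasurableSet A := measurableSet_Icc.prod measurableSet_Icc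
  set H : Set (ℝ × ℝ) := {p | p.1 + p.2 ≤ 1} with hH
  have hHm : MeasurableSet H := measurableSet_le (by fun_prop) (by fun_prop)
  set R : Set (ℝ × ℝ) := (fun p => (1 : ℝ × ℝ) - p) ⁻¹' (A \ H) with hR
  have hRm : MeasurableSet R := (measurable_const.sub measurable_id) (hAm.diff hHm)
  have hmemR : ∀ p : ℝ × ℝ, p ∈ R ↔
      ((0 ≤ 1 - p.1 ∧ 1 - p.1 ≤ 1) ∧ (0 ≤ 1 - p.2 ∧ 1 - p.2 ≤ 1)) ∧
        1 < (1 - p.1) + (1 - p.2) := by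
    intro p
    rw [← not_le]
    exact Iff.rfl
  have horigin := tendsto_sq_mul_setIntegral_triangle b ha (T := A ∩ H) (hAm.inter hHm)
    (fun p hp => ⟨hp.1.1.1, hp.1.2.1, hp.2⟩)
    (fun p h1 h2 h3 => ⟨⟨⟨h1, by linarith⟩, ⟨h2, by linarith⟩⟩, h3.le⟩)
    (h := fun p => Real.sqrt p.2) (by fun_prop)
    (fun p hp => by
      rw [abs_of_nonneg (Real.sqrt_nonneg _)]
      exact Real.sqrt_le_one.2 hp.1.2.2)
  have hcorner := tendsto_sq_mul_setIntegral_triangle b ha (T := R) hRm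
    (fun p hp => by
      rw [hmemR] at hp
      exact ⟨by linarith, by linarith, by linarith⟩)
    (fun p h1 h2 h3 => by
      rw [hmemR]
      refine ⟨⟨⟨?_, ?_⟩, ?_, ?_⟩, ?_⟩ <;> linarith)
    (h := fun p => Real.sqrt (1 - p.2)) (by fun_prop)
    (fun p hp => by
      rw [hmemR] at hp
      rw [abs_of_nonneg (Real.sqrt_nonneg _)]
      exact Real.sqrt_le_one.2 hp.1.2.2)
  have hsum := horigin.add hcorner
  simp only [Prod.snd_zero, Real.sqrt_zero, zero_mul, zero_add, sub_zero, Real.sqrt_one,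
    one_mul] at hsum
  refine hsum.congr fun u => ?_
  rw [← mul_add]
  congr 1
  have hint : IntegrableOn (fun p : ℝ × ℝ =>
      Real.sqrt p.2 * Real.exp (a * (2 * p.1 * p.2 - p.2 - p.1) * u) *
        Real.cos (b * (p.2 - p.1) * u)) A :=
    Continuous.continuousOn (by fun_prop) |>.integrableOn_compact (isCompact_Icc.prod isCompact_Icc)
  rw [← integral_inter_add_sdiff hHm hint]
  congr 1
  rw [← integral_indicator (hAm.diff hHm), ← integral_sub_left_eq_self _ volume (1 : ℝ × ℝ),
    ← integral_indicator hRm]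
  refine integral_congr_ae (ae_of_all _ fun p => ?_)
  by_cases hp : p ∈ R
  · have hp' : 1 - p ∈ A \ H := hp
    simp only [indicator_of_mem hp, indicator_of_mem hp', Prod.fst_sub, Prod.snd_sub,
      Prod.fst_one, Prod.snd_one]
    rw [← Real.cos_neg (b * (p.2 - p.1) * u)]
    ring_nf
  · have hp' : 1 - p ∉ A \ H := hp
    simp only [indicator_of_notMem hp, indicator_of_notMem hp']
end

section
/- Let a > 0. Then lim_{u→∞} u² ∫₀¹ ∫₀¹ √y · exp(a(2xy − y − x)u) dx dy = 1/a². -/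
open MeasureTheory Filter Set Topology

lemma integrableOn_Ici_prod_exp {c : ℝ} (hc : 0 < c) :
    IntegrableOn (fun p : ℝ × ℝ => Real.exp (-c * p.1) * Real.exp (-c * p.2))
      (Ici (0 : ℝ) ×ˢ Ici (0 : ℝ)) := by
  have h : IntegrableOn (fun x : ℝ => Real.exp (-c * x)) (Ici 0) :=
    (integrableOn_Ici_iff_integrableOn_Ioi (by simp)).2
      (integrableOn_exp_mul_Ioi (neg_neg_of_pos hc) 0)
  rw [IntegrableOn, Measure.volume_eq_prod, ← Measure.prod_restrict]
  exact Integrable.mul_prod h h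

lemma integral_Ici_prod_exp {c : ℝ} (hc : 0 < c) :
    ∫ p in Ici (0 : ℝ) ×ˢ Ici (0 : ℝ), Real.exp (-c * p.1) * Real.exp (-c * p.2) = 1 / c ^ 2 := by
  have h : ∫ x in Ici (0 : ℝ), Real.exp (-c * x) = 1 / c := by
    rw [integral_Ici_eq_integral_Ioi, integral_exp_mul_Ioi (neg_neg_of_pos hc)]
    simp
  rw [Measure.volume_eq_prod,
    setIntegral_prod_mul (fun x => Real.exp (-c * x)) (fun x => Real.exp (-c * x)), h]
  field_simp

/-- Laplace asymptotics at the corner `(0, 0)`, on the half of the unit square next to it. -/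
lemma tendsto_integral_corner {a L : ℝ} (ha : 0 < a) {ψ : ℝ × ℝ → ℝ} (hm : Measurable ψ)
    (hb : ∀ p : ℝ × ℝ, 0 ≤ p.1 → 0 ≤ p.2 → p.1 + p.2 ≤ 1 → |ψ p| ≤ 1)
    (hL : Tendsto ψ (𝓝 0) (𝓝 L)) :
    Tendsto (fun u : ℝ => u ^ 2 * ∫ p in {p : ℝ × ℝ | 0 ≤ p.1 ∧ 0 ≤ p.2 ∧ p.1 + p.2 ≤ 1},
        ψ p * Real.exp (a * (2 * p.1 * p.2 - p.2 - p.1) * u))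
      atTop (𝓝 (L * (1 / a ^ 2))) := by
  set D := {p : ℝ × ℝ | 0 ≤ p.1 ∧ 0 ≤ p.2 ∧ p.1 + p.2 ≤ 1} with hD
  have hDm : MeasurableSet D := by
    refine (measurableSet_le measurable_const measurable_fst).inter
      ((measurableSet_le measurable_const measurable_snd).inter
        (measurableSet_le (measurable_fst.add measurable_snd) measurable_const))
  have hQm : MeasurableSet (Ici (0 : ℝ) ×ˢ Ici (0 : ℝ)) := measurableSet_Ici.prod measurableSet_Ici
  set G : ℝ → ℝ × ℝ → ℝ := fun u =>
    D.indicator fun p => ψ p * Real.exp (a * (2 * p.1 * p.2 - p.2 - p.1) * u) with hG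
  have hscale : ∀ᶠ u : ℝ in atTop, ∫ p, G u (u⁻¹ • p) = u ^ 2 * ∫ p in D,
      ψ p * Real.exp (a * (2 * p.1 * p.2 - p.2 - p.1) * u) := by
    filter_upwards [eventually_gt_atTop 0] with u hu
    rw [Measure.integral_comp_smul, ← integral_indicator hDm]
    simp [hG]
  refine Tendsto.congr' hscale ?_
  rw [← integral_Ici_prod_exp ha, ← integral_const_mul, ← integral_indicator hQm]
  refine tendsto_integral_filter_of_dominated_convergence
    ((Ici (0 : ℝ) ×ˢ Ici (0 : ℝ)).indicator
      fun p => Real.exp (-(a / 2) * p.1) * Real.exp (-(a / 2) * p.2)) ?_ ?_ ?_ ?_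
  · refine Eventually.of_forall fun u => Measurable.aestronglyMeasurable ?_
    have : Measurable (G u) := (hm.mul (by fun_prop)).indicator hDm
    exact this.comp (measurable_const_smul u⁻¹)
  · filter_upwards [eventually_gt_atTop 0] with u hu
    refine Eventually.of_forall fun ⟨x, y⟩ => ?_
    by_cases hp : u⁻¹ • (x, y) ∈ D
    · have hp' := hp
      obtain ⟨h1, h2, h3⟩ := hp'
      simp only [Prod.smul_mk, smul_eq_mul] at h1 h2 h3
      have hx : 0 ≤ x := by simpa [hu] using h1
      have hy : 0 ≤ y := by simpa [hu] using h2
      have hψ := hb (u⁻¹ • (x, y)) h1 h2 h3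
      rw [hG]
      simp only
      rw [indicator_of_mem hp, indicator_of_mem (by exact ⟨hx, hy⟩), norm_mul, Real.norm_eq_abs,
        Real.norm_eq_abs, Real.abs_exp, ← Real.exp_add]
      refine (mul_le_of_le_one_left (Real.exp_nonneg _) hψ).trans (Real.exp_le_exp.2 ?_)
      simp only [Prod.smul_mk, smul_eq_mul]
      set s := u⁻¹ * x with hs
      set t := u⁻¹ * y with ht
      have hxs : x = u * s := by rw [hs]; field_simp
      have hyt : y = u * t := by rw [ht]; field_simp
      rw [hxs, hyt]
      have key : 0 ≤ (s + t) / 2 - 2 * s * t := by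
        nlinarith [sq_nonneg (s - t), mul_nonneg (add_nonneg h1 h2) (sub_nonneg.2 h3)]
      nlinarith [mul_nonneg (mul_pos ha hu).le key]
    · rw [hG]
      simp only
      rw [indicator_of_notMem hp, norm_zero]
      exact indicator_nonneg (fun _ _ => by positivity) _
  · exact (integrable_indicator_iff hQm).2 (integrableOn_Ici_prod_exp (half_pos ha))
  · refine Eventually.of_forall fun ⟨x, y⟩ => ?_
    have hinv : Tendsto (fun u : ℝ => u⁻¹) atTop (𝓝 0) := tendsto_inv_atTop_zero
    by_cases hp : (x, y) ∈ Ici (0 : ℝ) ×ˢ Ici (0 : ℝ)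
    · obtain ⟨hx, hy⟩ := hp
      simp only [mem_Ici] at hx hy
      rw [indicator_of_mem (by exact ⟨hx, hy⟩)]
      have hlim : Tendsto (fun u : ℝ => ψ (u⁻¹ • (x, y)) *
          Real.exp (a * (2 * x * y * u⁻¹ - y - x))) atTop
          (𝓝 (L * (Real.exp (-a * x) * Real.exp (-a * y)))) := by
        refine Tendsto.mul (hL.comp ?_) ?_
        · simpa using hinv.smul_const (x, y)
        · rw [← Real.exp_add]
          refine (Real.continuous_exp.tendsto _).comp ?_
          have := (((hinv.const_mul (2 * x * y)).sub_const y).sub_const x).const_mul a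
          convert this using 2
          ring
      refine hlim.congr' ?_
      filter_upwards [eventually_gt_atTop 0, eventually_ge_atTop (x + y)] with u hu hxy
      have hp : u⁻¹ • (x, y) ∈ D := by
        refine ⟨by simp only [Prod.smul_mk, smul_eq_mul]; positivity,
          by simp only [Prod.smul_mk, smul_eq_mul]; positivity, ?_⟩
        simp only [Prod.smul_mk, smul_eq_mul]
        rw [← mul_add, inv_mul_le_iff₀ hu]
        linarith
      rw [hG]
      simp only
      rw [indicator_of_mem hp]
      simp only [Prod.smul_mk, smul_eq_mul]
      congr 2
      field_simp
    · rw [indicator_of_notMem hp]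
      refine tendsto_const_nhds.congr' ?_
      filter_upwards [eventually_gt_atTop 0] with u hu
      rw [hG]
      simp only
      rw [indicator_of_notMem]
      rintro ⟨h1, h2, -⟩
      exact hp ⟨by simpa [hu] using h1, by simpa [hu] using h2⟩

/-- The limit of `D_u²` in the proof of Lemma 4.5:
`u² ∫₀¹ ∫₀¹ √y exp(a(2xy - y - x) u) dx dy → 1/a²` as `u → ∞`, for `a > 0`. -/
theorem limit_D_two (a : ℝ) (ha : 0 < a) :
    Tendsto
      (fun u : ℝ => u ^ 2 *
        ∫ p in Set.Icc (0 : ℝ) 1 ×ˢ Set.Icc (0 : ℝ) 1,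
          Real.sqrt p.2 * Real.exp (a * (2 * p.1 * p.2 - p.2 - p.1) * u))
      atTop (𝓝 (1 / a ^ 2)) := by
  set S := Icc (0 : ℝ) 1 ×ˢ Icc (0 : ℝ) 1 with hS
  set T := {p : ℝ × ℝ | p.1 + p.2 ≤ 1} with hT
  set D := {p : ℝ × ℝ | 0 ≤ p.1 ∧ 0 ≤ p.2 ∧ p.1 + p.2 ≤ 1} with hD
  have hTm : MeasurableSet T :=
    measurableSet_le (measurable_fst.add measurable_snd) measurable_const
  have hSm : MeasurableSet S := measurableSet_Icc.prod measurableSet_Icc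
  have hST : S ∩ T = D := by
    ext ⟨x, y⟩
    simp only [hS, hT, hD, mem_inter_iff, mem_prod, mem_Icc, mem_ofPred_eq]
    constructor
    · rintro ⟨⟨⟨h1, -⟩, h2, -⟩, h3⟩
      exact ⟨h1, h2, h3⟩
    · rintro ⟨h1, h2, h3⟩
      exact ⟨⟨⟨h1, by linarith⟩, h2, by linarith⟩, h3⟩
  have hDm : MeasurableSet D := hST ▸ hSm.inter hTm
  set E := {p : ℝ × ℝ | p.1 + p.2 < 1} with hE
  have hEm : MeasurableSet E :=
    measurableSet_lt (measurable_fst.add measurable_snd) measurable_const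
  have h₀ := tendsto_integral_corner (L := 0) ha (ψ := fun p => Real.sqrt p.2) (by fun_prop)
    (fun p h1 h2 h3 => by
      rw [abs_of_nonneg (Real.sqrt_nonneg _)]
      exact Real.sqrt_le_one.2 (by linarith))
    (by
      have : Continuous fun p : ℝ × ℝ => Real.sqrt p.2 := by fun_prop
      simpa using this.tendsto 0)
  have h₁ := tendsto_integral_corner (L := 1) ha
    (ψ := E.indicator fun p => Real.sqrt (1 - p.2))
    (Measurable.indicator (by fun_prop) hEm)
    (fun p h1 h2 h3 => by
      rw [abs_of_nonneg (indicator_nonneg (fun _ _ => Real.sqrt_nonneg _) _)]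
      exact indicator_apply_le' (fun _ => Real.sqrt_le_one.2 (by linarith)) fun _ => zero_le_one)
    (by
      have : Continuous fun p : ℝ × ℝ => Real.sqrt (1 - p.2) := by fun_prop
      have h : Tendsto (fun p : ℝ × ℝ => Real.sqrt (1 - p.2)) (𝓝 0) (𝓝 1) := by
        simpa using this.tendsto 0
      refine h.congr' ?_
      have hEo : IsOpen E := isOpen_lt (by fun_prop) (by fun_prop)
      filter_upwards [hEo.mem_nhds (show (0 : ℝ × ℝ) ∈ E by simp [hE])] with p hp
      rw [indicator_of_mem hp])
  have h := h₀.add h₁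
  rw [zero_mul, zero_add, one_mul] at h
  refine h.congr fun u => ?_
  rw [← mul_add]
  congr 1
  have hint : IntegrableOn (fun p : ℝ × ℝ =>
      Real.sqrt p.2 * Real.exp (a * (2 * p.1 * p.2 - p.2 - p.1) * u)) S :=
    ContinuousOn.integrableOn_compact (isCompact_Icc.prod isCompact_Icc)
      (Continuous.continuousOn (by fun_prop))
  rw [← integral_inter_add_sdiff hTm hint, hST]
  congr 1
  rw [← integral_indicator hDm, ← integral_indicator (hSm.diff hTm),
    ← integral_sub_left_eq_self _ _ ((1, 1) : ℝ × ℝ)]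
  refine integral_congr_ae (Eventually.of_forall fun ⟨x, y⟩ => ?_)
  simp only [indicator_apply, hD, hE, hS, hT, Set.mem_sdiff, mem_prod, mem_Icc, mem_ofPred_eq,
    Prod.mk_sub_mk]
  by_cases hxy : 1 < x + y
  · by_cases hd : x ≤ 1 ∧ y ≤ 1
    · rw [if_pos (by constructor <;> [skip; constructor] <;> linarith [hd.1, hd.2]),
        if_pos (by linarith), if_pos]
      · rw [sub_sub_cancel]
        congr 2
        ring
      · exact ⟨⟨⟨by linarith [hd.2], hd.1⟩, by linarith [hd.1], hd.2⟩, by linarith⟩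
    · rw [if_neg fun h => hd ⟨by linarith [h.1], by linarith [h.2.1]⟩,
        if_neg fun h => hd ⟨h.1.1.2, h.1.2.2⟩]
  · rw [if_neg (show ¬ (1 - x + (1 - y) < 1) by linarith),
      if_neg (show ¬ (((0 ≤ x ∧ x ≤ 1) ∧ 0 ≤ y ∧ y ≤ 1) ∧ ¬ x + y ≤ 1) from
        fun h => h.2 (not_lt.1 hxy))]
    simp
end

section
/- Let a > 0 and b ∈ ℝ. Then lim_{u→∞} u² ∫₀¹ ∫₀¹ √(xy) · exp(a(2xy − y − x)u) · cos(b(y − x)u) dx dy = 1/(a² + b²). -/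
open MeasureTheory Filter Set Topology

/-- The kernel `exp(a(2xy - y - x)u) cos(b(y - x)u)`, invariant under `(x, y) ↦ (1 - x, 1 - y)`. -/
noncomputable def expCosKernel (a b u : ℝ) (p : ℝ × ℝ) : ℝ :=
  Real.exp (a * (2 * p.1 * p.2 - p.2 - p.1) * u) * Real.cos (b * (p.2 - p.1) * u)

lemma continuous_expCosKernel (a b u : ℝ) : Continuous (expCosKernel a b u) := by
  unfold expCosKernel
  fun_prop

lemma expCosKernel_one_sub (a b u : ℝ) (p : ℝ × ℝ) :
    expCosKernel a b u (1 - p) = expCosKernel a b u p := by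
  simp only [expCosKernel, Prod.fst_sub, Prod.snd_sub, Prod.fst_one, Prod.snd_one]
  rw [← Real.cos_neg]
  ring_nf

lemma abs_expCosKernel_le {a u : ℝ} (b : ℝ) (ha : 0 < a) (hu : 0 < u) {p : ℝ × ℝ}
    (h1 : 0 ≤ p.1) (h2 : 0 ≤ p.2) (h : p.1 + p.2 ≤ 1) :
    |expCosKernel a b u p| ≤ Real.exp (-(a / 2) * (u * p.1)) * Real.exp (-(a / 2) * (u * p.2)) := by
  rw [expCosKernel, abs_mul, Real.abs_exp, ← Real.exp_add]
  refine (mul_le_of_le_one_right (Real.exp_pos _).le (Real.abs_cos_le_one _)).trans ?_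
  rw [Real.exp_le_exp]
  have key : 2 * p.1 * p.2 - p.2 - p.1 ≤ -(p.1 + p.2) / 2 := by
    nlinarith [sq_nonneg (p.1 - p.2), mul_nonneg (add_nonneg h1 h2) (sub_nonneg.2 h)]
  nlinarith [mul_le_mul_of_nonneg_left key (mul_pos ha hu).le]

lemma tendsto_sq_mul_setIntegral_expCosKernel {a : ℝ} (b : ℝ) (ha : 0 < a) {T : Set (ℝ × ℝ)}
    (hT : MeasurableSet T) (hT_le : ∀ p ∈ T, 0 ≤ p.1 ∧ 0 ≤ p.2 ∧ p.1 + p.2 ≤ 1)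
    (hT_lt : ∀ p : ℝ × ℝ, 0 ≤ p.1 → 0 ≤ p.2 → p.1 + p.2 < 1 → p ∈ T)
    {g : ℝ × ℝ → ℝ} (hg : Continuous g) (hg_le : ∀ p ∈ T, |g p| ≤ 1) :
    Tendsto (fun u : ℝ => u ^ 2 * ∫ p in T, g p * expCosKernel a b u p) atTop
      (𝓝 (g 0 * (1 / (a ^ 2 + b ^ 2)))) := by
  set E : ℝ → ℝ := (Ici 0).indicator fun x => Real.exp (-(a / 2) * x) with hE
  have hEint : Integrable E := by
    rw [hE, integrable_indicator_iff measurableSet_Ici, integrableOn_Ici_iff_integrableOn_Ioi]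
    exact exp_neg_integrableOn_Ioi 0 (half_pos ha)
  have hscale : ∀ᶠ u : ℝ in atTop,
      ∫ p, T.indicator (fun p => g p * expCosKernel a b u p) (u⁻¹ • p) =
        u ^ 2 * ∫ p in T, g p * expCosKernel a b u p := by
    filter_upwards [eventually_gt_atTop 0] with u hu
    rw [Measure.integral_comp_smul, integral_indicator hT]
    simp [abs_of_pos hu]
  refine Tendsto.congr' hscale ?_
  rw [← integral_exp_mul_cos_quadrant b ha, ← integral_const_mul,
    ← integral_indicator (measurableSet_Ici.prod measurableSet_Ici)]
  refine tendsto_integral_filter_of_dominated_convergence (fun p => E p.1 * E p.2) ?_ ?_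
    (hEint.mul_prod hEint) ?_
  · refine Eventually.of_forall fun u => Measurable.aestronglyMeasurable ?_
    exact ((hg.mul (continuous_expCosKernel a b u)).measurable.indicator hT).comp
      (measurable_const_smul u⁻¹)
  · filter_upwards [eventually_gt_atTop 0] with u hu
    refine Eventually.of_forall fun p => ?_
    have hE0 (x : ℝ) : 0 ≤ E x := indicator_nonneg (fun _ _ => (Real.exp_pos _).le) x
    by_cases hp : u⁻¹ • p ∈ T
    · obtain ⟨h1, h2, h3⟩ := hT_le _ hp
      have hk := abs_expCosKernel_le b ha hu h1 h2 h3
      simp only [Prod.smul_fst, Prod.smul_snd, smul_eq_mul] at h1 h2 hk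
      rw [mul_inv_cancel_left₀ hu.ne', mul_inv_cancel_left₀ hu.ne'] at hk
      have h1' : p.1 ∈ Ici (0 : ℝ) := nonneg_of_mul_nonneg_right h1 (inv_pos.2 hu)
      have h2' : p.2 ∈ Ici (0 : ℝ) := nonneg_of_mul_nonneg_right h2 (inv_pos.2 hu)
      rw [indicator_of_mem hp, hE, indicator_of_mem h1', indicator_of_mem h2', norm_mul]
      exact (mul_le_of_le_one_left (norm_nonneg _) (hg_le _ hp)).trans hk
    · rw [indicator_of_notMem hp, norm_zero]
      exact mul_nonneg (hE0 _) (hE0 _)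
  · refine Eventually.of_forall fun p => ?_
    have hinv : Tendsto (fun u : ℝ => u⁻¹ • p) atTop (𝓝 0) := by
      simpa using (tendsto_inv_atTop_zero (𝕜 := ℝ)).smul_const p
    by_cases hp : p ∈ Ici (0 : ℝ) ×ˢ Ici (0 : ℝ)
    · rw [indicator_of_mem hp]
      obtain ⟨h1, h2⟩ := hp
      have hsum : Tendsto (fun u : ℝ => (u⁻¹ • p).1 + (u⁻¹ • p).2) atTop (𝓝 0) := by
        have hc : Continuous fun q : ℝ × ℝ => q.1 + q.2 := by fun_prop
        have h := (hc.tendsto 0).comp hinv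
        rwa [Prod.fst_zero, Prod.snd_zero, add_zero] at h
      have hlim : Tendsto (fun u : ℝ => g (u⁻¹ • p) *
          (Real.exp (a * (2 * p.1 * p.2 * u⁻¹ - p.2 - p.1)) * Real.cos (b * (p.2 - p.1))))
          atTop (𝓝 (g 0 * (Real.exp (-a * (p.1 + p.2)) * Real.cos (b * (p.2 - p.1))))) := by
        refine ((hg.tendsto 0).comp hinv).mul (Tendsto.mul_const _ ?_)
        have hc : Continuous fun v : ℝ => Real.exp (a * (2 * p.1 * p.2 * v - p.2 - p.1)) := by
          fun_prop
        have h0 : -a * (p.1 + p.2) = a * (2 * p.1 * p.2 * 0 - p.2 - p.1) := by ring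
        rw [h0]
        exact (hc.tendsto 0).comp tendsto_inv_atTop_zero
      refine hlim.congr' ?_
      filter_upwards [eventually_gt_atTop 0, hsum.eventually_lt_const one_pos] with u hu hlt
      have hmem : u⁻¹ • p ∈ T := hT_lt _ (mul_nonneg (inv_pos.2 hu).le h1)
        (mul_nonneg (inv_pos.2 hu).le h2) hlt
      rw [indicator_of_mem hmem]
      simp only [expCosKernel, Prod.smul_fst, Prod.smul_snd, smul_eq_mul]
      congr 3 <;> field_simp
    · rw [indicator_of_notMem hp]
      refine tendsto_const_nhds.congr' ?_
      filter_upwards [eventually_gt_atTop 0] with u hu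
      refine (indicator_of_notMem (fun hmem => hp ?_) _).symm
      obtain ⟨h1, h2, -⟩ := hT_le _ hmem
      exact ⟨nonneg_of_mul_nonneg_right h1 (inv_pos.2 hu),
        nonneg_of_mul_nonneg_right h2 (inv_pos.2 hu)⟩

/-- The limit of `C_u` in the proof of Lemma 4.5:
`u² ∫₀¹ ∫₀¹ √(xy) exp(a(2xy - y - x) u) cos(b(y - x) u) dx dy → 1/(a² + b²)` as `u → ∞`. -/
theorem limit_C (a b : ℝ) (ha : 0 < a) :
    Tendsto
      (fun u : ℝ => u ^ 2 *
        ∫ p in Set.Icc (0 : ℝ) 1 ×ˢ Set.Icc (0 : ℝ) 1,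
          Real.sqrt (p.1 * p.2) * Real.exp (a * (2 * p.1 * p.2 - p.2 - p.1) * u) *
            Real.cos (b * (p.2 - p.1) * u))
      atTop (𝓝 (1 / (a ^ 2 + b ^ 2))) := by
  set Q : Set (ℝ × ℝ) := Icc (0 : ℝ) 1 ×ˢ Icc (0 : ℝ) 1
  have hQm : MeasurableSet Q := measurableSet_Icc.prod measurableSet_Icc
  set A : Set (ℝ × ℝ) := {p | p.1 + p.2 < 1} with hA
  have hAm : MeasurableSet A := measurableSet_lt (by fun_prop) (by fun_prop)
  set B : Set (ℝ × ℝ) := Q ∩ {p | p.1 + p.2 ≤ 1} with hB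
  have hBm : MeasurableSet B := hQm.inter (measurableSet_le (by fun_prop) (by fun_prop))
  set g : ℝ × ℝ → ℝ := fun p => Real.sqrt (p.1 * p.2) with hg
  have hgc : Continuous g := by fun_prop
  have hg_le : ∀ p ∈ Q, |g p| ≤ 1 := by
    rintro p ⟨⟨h1, h1'⟩, h2, h2'⟩
    rw [abs_of_nonneg (Real.sqrt_nonneg _), Real.sqrt_le_one]
    exact mul_le_one₀ h1' h2 h2'
  have hQ_sub : ∀ p ∈ Q, 1 - p ∈ Q := by
    rintro p ⟨⟨h1, h1'⟩, h2, h2'⟩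
    exact ⟨⟨sub_nonneg.2 h1', sub_le_self _ h1⟩, sub_nonneg.2 h2', sub_le_self _ h2⟩
  have hlimA := tendsto_sq_mul_setIntegral_expCosKernel b ha (hQm.inter hAm)
    (fun p hp => ⟨hp.1.1.1, hp.1.2.1, le_of_lt hp.2⟩)
    (fun p h1 h2 h => ⟨⟨⟨h1, by linarith⟩, h2, by linarith⟩, h⟩) hgc
    (fun p hp => hg_le p hp.1)
  have hlimB := tendsto_sq_mul_setIntegral_expCosKernel b ha hBm
    (fun p hp => ⟨hp.1.1.1, hp.1.2.1, hp.2⟩)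
    (fun p h1 h2 h => ⟨⟨⟨h1, by linarith⟩, h2, by linarith⟩, h.le⟩)
    (g := fun p => g (1 - p)) (by fun_prop)
    (fun p hp => hg_le _ (hQ_sub p hp.1))
  have hreflect (u : ℝ) : ∫ p in B, g (1 - p) * expCosKernel a b u p =
      ∫ p in Q \ A, g p * expCosKernel a b u p := by
    rw [← integral_indicator hBm, ← integral_indicator (hQm.diff hAm),
      ← integral_sub_left_eq_self _ volume (1 : ℝ × ℝ)]
    congr 1
    ext p
    have hiff : 1 - p ∈ B ↔ p ∈ Q \ A := by
      have hQ_iff : 1 - p ∈ Q ↔ p ∈ Q :=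
        ⟨fun h => by simpa using hQ_sub _ h, hQ_sub p⟩
      simp only [hB, hA, mem_inter_iff, hQ_iff, Set.mem_sdiff, mem_ofPred_eq, not_lt, Prod.fst_sub,
        Prod.snd_sub, Prod.fst_one, Prod.snd_one]
      exact and_congr_right fun _ => ⟨fun h => by linarith, fun h => by linarith⟩
    by_cases hp : p ∈ Q \ A
    · rw [indicator_of_mem (hiff.2 hp), indicator_of_mem hp, sub_sub_cancel, expCosKernel_one_sub]
    · rw [indicator_of_notMem (mt hiff.1 hp), indicator_of_notMem hp]
  have hsplit (u : ℝ) : (∫ p in Q ∩ A, g p * expCosKernel a b u p) +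
      ∫ p in Q \ A, g p * expCosKernel a b u p = ∫ p in Q, g p * expCosKernel a b u p :=
    integral_inter_add_sdiff hAm
      ((hgc.mul (continuous_expCosKernel a b u)).continuousOn.integrableOn_compact
        (isCompact_Icc.prod isCompact_Icc))
  have hadd := hlimA.add hlimB
  simp only [hreflect, ← mul_add, hsplit] at hadd
  convert hadd using 2
  · simp only [hg, expCosKernel, mul_assoc]
  · simp [hg]
end
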